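/- Fix N ∈ ℕ, weights w_1,…,w_N > 0, colors c_1,…,c_N ∈ ℝ^3, τ > 0 and κ ∈ ℝ. For (t, f) ∈ ℝ^N × ℝ^N define opacities α_i(f) = 1 − exp(−g(f_i)) with g(u) = −2 ln Ψ(κ − u), and define C(t, f) = Σ_{i=1}^N ĉ_{σ(i)}(t) α_{σ(i)}(f) Π_{j=1}^{i−1} (1 − α_{σ(j)}(f)), where σ is any permutation of {1,…,N} with t_{σ(1)} ≤ … ≤ t_{σ(N)} (this value does not depend on the choice of such σ, since ĉ_i(t) = ĉ_{i′}(t) whenever t_i = t_{i′}). Then C : ℝ^N × ℝ^N → ℝ^3 is a continuous function of (t, f). -/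

import Mathlib

open Finset

/-- The cumulative distribution function of the standard normal distribution. -/
noncomputable def stdNormalCDF (x : ℝ) : ℝ :=
  ∫ u in Set.Iic x, Real.exp (-u ^ 2 / 2) / Real.sqrt (2 * Real.pi)

/-- The footprint `g(u) = −2 ln Ψ(κ − u)` of a geometry-field value `u`. -/
noncomputable def footprint (κ u : ℝ) : ℝ := -2 * Real.log (stdNormalCDF (κ - u))

/-- The blended color of the `i`-th kernel:
`ĉ_i = [Σ_j (1 − e^{−w_j}) e^{−τ|t_j − t_i|} c_j] / [Σ_j (1 − e^{−w_j}) e^{−τ|t_j − t_i|}]`. -/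
noncomputable def blendedColor {N : ℕ} (w : Fin N → ℝ)
    (c : Fin N → EuclideanSpace ℝ (Fin 3)) (τ : ℝ) (t : Fin N → ℝ) (i : Fin N) :
    EuclideanSpace ℝ (Fin 3) :=
  (∑ j, (1 - Real.exp (-w j)) * Real.exp (-τ * |t j - t i|))⁻¹ •
    ∑ j, ((1 - Real.exp (-w j)) * Real.exp (-τ * |t j - t i|)) • c j

/-- The splatted color `C(t, f)` of depths `t` and geometry-field values `f`, with
opacities `α_i(f) = 1 − exp(−g(f_i))` and blended colors `ĉ_i(t)`, composited in the
order of a permutation sorting the depths nondecreasingly (here `Tuple.sort t`; by the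
tie property of the blended colors the value does not depend on the choice of such a
sorting permutation). -/
noncomputable def splattedColor {N : ℕ} (w : Fin N → ℝ)
    (c : Fin N → EuclideanSpace ℝ (Fin 3)) (τ κ : ℝ) (t f : Fin N → ℝ) :
    EuclideanSpace ℝ (Fin 3) :=
  ∑ i, ((1 - Real.exp (-footprint κ (f (Tuple.sort t i)))) *
      ∏ j ∈ Finset.Iio i, Real.exp (-footprint κ (f (Tuple.sort t j)))) •
    blendedColor w c τ t (Tuple.sort t i)

lemma integrable_gaussian_density :
    MeasureTheory.Integrable fun u : ℝ => Real.exp (-u ^ 2 / 2) / Real.sqrt (2 * Real.pi) := by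
  refine ((integrable_exp_neg_mul_sq (b := 1 / 2) (by norm_num)).congr
    (.of_forall fun u => ?_)).div_const _
  ring_nf

lemma continuous_stdNormalCDF : Continuous stdNormalCDF := by
  have h : stdNormalCDF = fun x => stdNormalCDF 0 +
      ∫ u in (0 : ℝ)..x, Real.exp (-u ^ 2 / 2) / Real.sqrt (2 * Real.pi) := by
    funext x
    rw [← intervalIntegral.integral_Iic_sub_Iic integrable_gaussian_density.integrableOn
      integrable_gaussian_density.integrableOn]
    simp [stdNormalCDF]
  rw [h]
  exact continuous_const.add (intervalIntegral.continuous_primitive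
    (fun _ _ => integrable_gaussian_density.intervalIntegrable) 0)

lemma stdNormalCDF_pos (x : ℝ) : 0 < stdNormalCDF x := by
  have hpos (u : ℝ) : 0 < Real.exp (-u ^ 2 / 2) / Real.sqrt (2 * Real.pi) := by positivity
  rw [stdNormalCDF, MeasureTheory.setIntegral_pos_iff_support_of_nonneg_ae
    (.of_forall fun u => (hpos u).le) integrable_gaussian_density.integrableOn,
    Function.support_eq_univ fun u => (hpos u).ne']
  simp

lemma continuous_footprint (κ : ℝ) : Continuous (footprint κ) :=
  continuous_const.mul ((continuous_stdNormalCDF.comp (continuous_const.sub continuous_id)).log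
    fun _ => (stdNormalCDF_pos _).ne')

lemma continuous_blendedColor {N : ℕ} {w : Fin N → ℝ} (c : Fin N → EuclideanSpace ℝ (Fin 3))
    (τ : ℝ) (hw : ∀ j, 0 < w j) (i : Fin N) : Continuous fun t => blendedColor w c τ t i := by
  have hden (t : Fin N → ℝ) :
      ∑ j, (1 - Real.exp (-w j)) * Real.exp (-τ * |t j - t i|) ≠ 0 := by
    refine (Finset.sum_pos (fun j _ => mul_pos ?_ (Real.exp_pos _)) ⟨i, mem_univ i⟩).ne'
    simpa using hw j
  unfold blendedColor
  exact (Continuous.inv₀ (by fun_prop) hden).smul (by fun_prop)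

/-- The color of the kernels with transmittances `b` and colors `v`, composited in the order `σ`. -/
noncomputable def composite {N : ℕ} {E : Type*} [AddCommGroup E] [Module ℝ E]
    (σ : Equiv.Perm (Fin N)) (b : Fin N → ℝ) (v : Fin N → E) : E :=
  ∑ i, ((1 - b (σ i)) * ∏ j ∈ Iio i, b (σ j)) • v (σ i)

lemma sum_weights_of_isLowerSet {N : ℕ} (b : Fin N → ℝ) (s : Finset (Fin N))
    (hs : IsLowerSet (s : Set (Fin N))) :
    ∑ i ∈ s, (1 - b i) * ∏ j ∈ Iio i, b j = 1 - ∏ i ∈ s, b i := by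
  have h := prod_one_sub_ordered s fun i => 1 - b i
  simp only [sub_sub_cancel] at h
  rw [h, sub_sub_cancel]
  refine sum_congr rfl fun i hi => ?_
  congr 2
  ext j
  simpa using fun hj => hs (le_of_lt hj) hi

/-- A composite in depth order, grouped by depth, does not mention the sorting permutation. -/
lemma composite_eq_sum_depths {N : ℕ} {E : Type*} [AddCommGroup E] [Module ℝ E]
    {σ : Equiv.Perm (Fin N)} {t : Fin N → ℝ} (hσ : Monotone (t ∘ σ)) (b : Fin N → ℝ) (d : ℝ → E) :
    composite σ b (d ∘ t) =
      ∑ x ∈ univ.image t, ((∏ k with t k < x, b k) - ∏ k with t k ≤ x, b k) • d x := by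
  have hprod (p : ℝ → Prop) [DecidablePred p] :
      ∏ i with p (t (σ i)), b (σ i) = ∏ k with p (t k), b k := by
    simp only [prod_filter]
    exact Equiv.prod_comp σ fun k => if p (t k) then b k else 1
  have hlt (x : ℝ) := sum_weights_of_isLowerSet (b ∘ σ) (univ.filter fun i => t (σ i) < x)
    fun i j hji hi => by simpa using (hσ hji).trans_lt (by simpa using hi)
  have hle (x : ℝ) := sum_weights_of_isLowerSet (b ∘ σ) (univ.filter fun i => t (σ i) ≤ x)
    fun i j hji hi => by simpa using (hσ hji).trans (by simpa using hi)
  have hsplit (x : ℝ) (m : Fin N → ℝ) : ∑ i with t (σ i) ≤ x, m i =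
      (∑ i with t (σ i) < x, m i) + ∑ i with t (σ i) = x, m i := by
    rw [← sum_union (disjoint_filter.2 fun _ _ h => h.ne), ← filter_or]
    simp only [le_iff_lt_or_eq]
  have hmaps : ∀ i ∈ univ, t (σ i) ∈ univ.image t := fun i _ => mem_image_of_mem t (mem_univ _)
  rw [composite, ← sum_fiberwise_of_maps_to hmaps]
  refine sum_congr rfl fun x _ => ?_
  have hx := hle x
  rw [hsplit, hlt] at hx
  simp only [Function.comp_apply] at hx
  rw [hprod (· < x), hprod (· ≤ x)] at hx
  rw [show (∏ k with t k < x, b k) - ∏ k with t k ≤ x, b k =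
    ∑ i with t (σ i) = x, (1 - b (σ i)) * ∏ j ∈ Iio i, b (σ j) by linarith, sum_smul]
  refine sum_congr rfl fun i hi => ?_
  simp [(mem_filter.1 hi).2]

lemma splattedColor_eq_composite {N : ℕ} (w : Fin N → ℝ) (c : Fin N → EuclideanSpace ℝ (Fin 3))
    (τ κ : ℝ) {t : Fin N → ℝ} (f : Fin N → ℝ) {σ : Equiv.Perm (Fin N)} (hσ : Monotone (t ∘ σ)) :
    splattedColor w c τ κ t f =
      composite σ (fun i => Real.exp (-footprint κ (f i))) (blendedColor w c τ t) := by
  let d (x : ℝ) : EuclideanSpace ℝ (Fin 3) :=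
    (∑ j, (1 - Real.exp (-w j)) * Real.exp (-τ * |t j - x|))⁻¹ •
      ∑ j, ((1 - Real.exp (-w j)) * Real.exp (-τ * |t j - x|)) • c j
  have hd : blendedColor w c τ t = d ∘ t := by
    funext i
    simp only [blendedColor, d, Function.comp_apply]
  calc
    splattedColor w c τ κ t f = composite (Tuple.sort t)
        (fun i => Real.exp (-footprint κ (f i))) (blendedColor w c τ t) := by
      simp only [splattedColor, composite]
    _ = _ := by
      rw [hd, composite_eq_sum_depths (Tuple.monotone_sort t), composite_eq_sum_depths hσ]

/-- Theorem 2: with the blended colors, the splatted color is a continuous function of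
the depths and geometry-field values `(t, f) ∈ ℝ^N × ℝ^N` of the Gaussian surfels. -/
theorem splattedColor_continuous {N : ℕ} (w : Fin N → ℝ)
    (c : Fin N → EuclideanSpace ℝ (Fin 3)) (τ κ : ℝ)
    (hw : ∀ j, 0 < w j) (hτ : 0 < τ) :
    Continuous fun p : (Fin N → ℝ) × (Fin N → ℝ) =>
      splattedColor w c τ κ p.1 p.2 := by
  refine (locallyFinite_of_finite fun σ : Equiv.Perm (Fin N) =>
    {p : (Fin N → ℝ) × (Fin N → ℝ) | Monotone (p.1 ∘ σ)}).continuous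
    (Set.iUnion_eq_univ_iff.2 fun p => ⟨Tuple.sort p.1, Tuple.monotone_sort p.1⟩)
    (fun σ => ?_) (fun σ => ?_)
  · simp only [Monotone, Set.ofPred_forall]
    exact isClosed_iInter fun i => isClosed_iInter fun j => isClosed_iInter fun _ =>
      isClosed_le (by fun_prop) (by fun_prop)
  · have hfoot := continuous_footprint κ
    have hblend := continuous_blendedColor c τ hw
    refine Continuous.continuousOn (f := fun p : (Fin N → ℝ) × (Fin N → ℝ) =>
      composite σ (fun i => Real.exp (-footprint κ (p.2 i))) (blendedColor w c τ p.1)) ?_ |>.congr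
      fun p hp => splattedColor_eq_composite w c τ κ p.2 hp
    unfold composite
    fun_prop
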